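/- arXiv:2203.13101 — 2 statements merged into one kernel-verified Lean document; each statement's English description precedes it below -/
import Mathlib

section
/- Let n ≥ 1, 1 ≤ p < ∞ and 0 < σ < 1. There exists a constant C > 0, depending only on n, p, σ, such that for every Schwartz function f : ℝⁿ → ℝ one has (1/Γ(1−σ/2)) ∫₀^{+∞} t^{−σ/2} ‖Δ(h_t ∗ f)‖_{L^p(ℝⁿ)} dt ≤ C ‖f‖_{L^p(ℝⁿ)}^{1−σ} ‖∇f‖_{L^p(ℝⁿ)}^{σ}, where h_t ∗ f denotes convolution with the Gaussian heat kernel and Δ is the Laplacian in the space variable. -/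
open MeasureTheory
open scoped LineDeriv

/-- Convolution in the Lebesgue sense, dominated by kernel. -/
theorem aux_young {n : ℕ} (p : ℝ) (hp : 1 ≤ p) (G g : EuclideanSpace ℝ (Fin n) → ℝ)
    (hG : Continuous G) (hg : Continuous g) (F : EuclideanSpace ℝ (Fin n) → ℝ) (c : ENNReal)
    (hF : ∀ x, ‖F x‖ₑ ≤ c * ∫⁻ w, ‖G (x - w)‖ₑ * ‖g w‖ₑ) :
    eLpNorm F (ENNReal.ofReal p) volume ≤
      c * (∫⁻ y, ‖G y‖ₑ) * eLpNorm g (ENNReal.ofReal p) volume := by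
  have hp0 : 0 < p := by linarith
  have hpne : ENNReal.ofReal p ≠ 0 := by simpa using hp0
  have hinv : 0 ≤ 1 / p := by positivity
  have hinv1 : 1 / p ≤ 1 := by rw [div_le_one hp0]; exact hp
  rw [eLpNorm_eq_lintegral_rpow_enorm_toReal hpne ENNReal.ofReal_ne_top,
    eLpNorm_eq_lintegral_rpow_enorm_toReal hpne ENNReal.ofReal_ne_top,
    ENNReal.toReal_ofReal hp0.le]
  set I := ∫⁻ y, ‖G y‖ₑ with hI
  have hsub : ∀ x, ∫⁻ w, ‖G (x - w)‖ₑ = I := fun x => by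
    rw [hI]; exact lintegral_sub_left_eq_self (fun y => ‖G y‖ₑ) x
  have h1 : ∀ x, ∫⁻ w, ‖G (x - w)‖ₑ * ‖g w‖ₑ ≤
      I ^ (1 - 1/p) * (∫⁻ w, ‖G (x - w)‖ₑ * ‖g w‖ₑ ^ p) ^ (1/p) := by
    intro x
    have := ENNReal.lintegral_mul_norm_pow_le (μ := volume)
      (f := fun w => ‖G (x - w)‖ₑ) (g := fun w => ‖G (x - w)‖ₑ * ‖g w‖ₑ ^ p)
      (by fun_prop) (by fun_prop) (p := 1 - 1/p) (q := 1/p) (by linarith) hinv (by ring)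
    rw [hsub] at this
    refine le_trans (le_of_eq ?_) this
    congr 1; ext w
    rw [ENNReal.mul_rpow_of_nonneg _ _ hinv, ← ENNReal.rpow_mul, mul_one_div_cancel hp0.ne',
      ENNReal.rpow_one, ← mul_assoc, ← ENNReal.rpow_add_of_nonneg _ _ (by linarith) hinv]
    simp
  have h2 : ∀ x, ‖F x‖ₑ ^ p ≤
      (c * I ^ (1 - 1/p)) ^ p * ∫⁻ w, ‖G (x - w)‖ₑ * ‖g w‖ₑ ^ p := by
    intro x
    calc ‖F x‖ₑ ^ p ≤ (c * (I ^ (1 - 1/p) * (∫⁻ w, ‖G (x - w)‖ₑ * ‖g w‖ₑ ^ p) ^ (1/p))) ^ p := by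
          gcongr; exact (hF x).trans (by gcongr; exact h1 x)
      _ = _ := by
          rw [← mul_assoc, ENNReal.mul_rpow_of_nonneg _ _ hp0.le, ← ENNReal.rpow_mul _ (1/p) p,
            one_div_mul_cancel hp0.ne', ENNReal.rpow_one]
  have h3 : ∫⁻ x, ∫⁻ w, ‖G (x - w)‖ₑ * ‖g w‖ₑ ^ p = I * ∫⁻ w, ‖g w‖ₑ ^ p := by
    rw [lintegral_lintegral_swap (by fun_prop)]
    have : ∀ w, ∫⁻ x, ‖G (x - w)‖ₑ * ‖g w‖ₑ ^ p = I * ‖g w‖ₑ ^ p := by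
      intro w
      have hm : Measurable fun x => ‖G (x - w)‖ₑ := by
        have : Continuous fun x => G (x - w) := by fun_prop
        exact this.enorm.measurable
      rw [lintegral_mul_const _ hm]
      congr 1
      exact lintegral_sub_right_eq_self (fun y => ‖G y‖ₑ) w
    simp_rw [this]
    rw [lintegral_const_mul _ (by fun_prop)]
  calc (∫⁻ x, ‖F x‖ₑ ^ p) ^ (1/p)
      ≤ ((c * I ^ (1 - 1/p)) ^ p * (I * ∫⁻ w, ‖g w‖ₑ ^ p)) ^ (1/p) := by
        gcongr
        rw [← h3, ← lintegral_const_mul _ (by fun_prop)]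
        exact lintegral_mono h2
    _ = _ := by
        rw [ENNReal.mul_rpow_of_nonneg _ _ hinv, ENNReal.mul_rpow_of_nonneg _ _ hinv,
          ← ENNReal.rpow_mul, mul_one_div_cancel hp0.ne', ENNReal.rpow_one, ← mul_assoc,
          mul_assoc c, ← ENNReal.rpow_add_of_nonneg _ _ (by linarith) hinv]
        simp

theorem aux_diff {n : ℕ} (K : EuclideanSpace ℝ (Fin n) → ℝ) (hK : Continuous K)
    (hKi : Integrable K) (φ : SchwartzMap (EuclideanSpace ℝ (Fin n)) ℝ)
    (x v : EuclideanSpace ℝ (Fin n)) :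
    fderiv ℝ (fun z => ∫ w, K (z - w) * φ w) x v = ∫ w, K (x - w) * (∂_{v} φ) w := by
  have e0 : ∀ (ψ : SchwartzMap (EuclideanSpace ℝ (Fin n)) ℝ) (z : EuclideanSpace ℝ (Fin n)),
      ∫ w, K (z - w) * ψ w = ∫ w, K w * ψ (z - w) := by
    intro ψ z
    rw [← integral_sub_left_eq_self (fun w => K w * ψ (z - w)) volume z]
    simp
  have e1 : (fun z => ∫ w, K (z - w) * φ w) = fun z => ∫ w, K w * φ (z - w) :=
    funext fun z => e0 φ z
  have e2 := e0 (∂_{v} φ) x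
  rw [e1, e2]
  set D := SchwartzMap.fderivCLM ℝ _ _ φ with hD
  have hint : ∀ z, Integrable (fun w => K w * φ (z - w)) := fun z =>
    hKi.mul_bdd (c := SchwartzMap.seminorm ℝ 0 0 φ)
      (φ.continuous.comp (by fun_prop)).aestronglyMeasurable
      (Filter.Eventually.of_forall fun w => φ.norm_le_seminorm ℝ _)
  have hcD : Continuous (fun w => K w • D (x - w)) :=
    hK.smul (D.continuous.comp (by fun_prop))
  have key := hasFDerivAt_integral_of_dominated_of_fderiv_le (𝕜 := ℝ) (μ := volume)
    (F := fun z w => K w * φ (z - w)) (F' := fun z w => K w • D (z - w))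
    (bound := fun w => ‖K w‖ * SchwartzMap.seminorm ℝ 0 0 D) (x₀ := x) (s := Set.univ)
    Filter.univ_mem (Filter.Eventually.of_forall fun z => (hint z).aestronglyMeasurable)
    (hint x) hcD.aestronglyMeasurable
    (Filter.Eventually.of_forall fun w z _ => by
      rw [norm_smul]; gcongr; exact D.norm_le_seminorm ℝ _)
    (hKi.norm.mul_const _)
    (Filter.Eventually.of_forall fun w z _ => by
      have h := (φ.differentiableAt (x := z - w)).hasFDerivAt
      have h' := h.comp z ((hasFDerivAt_id z).sub_const w)
      exact (h'.const_mul (K w)))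
  rw [key.fderiv]
  rw [ContinuousLinearMap.integral_apply]
  · congr 1
  · refine (hKi.norm.mul_const (SchwartzMap.seminorm ℝ 0 0 D)).mono' hcD.aestronglyMeasurable
      (Filter.Eventually.of_forall fun w => ?_)
    rw [norm_smul]; gcongr; exact D.norm_le_seminorm ℝ _

theorem aux_ibp {n : ℕ} (K K' : EuclideanSpace ℝ (Fin n) → ℝ)
    (hKi : Integrable K) (hKi' : Integrable K')
    (φ : SchwartzMap (EuclideanSpace ℝ (Fin n)) ℝ)
    (x v : EuclideanSpace ℝ (Fin n)) (hd : ∀ y, HasLineDerivAt ℝ K (K' y) y v) :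
    ∫ w, K (x - w) * (∂_{v} φ) w = ∫ w, K' (x - w) * φ w := by
  have hi : ∀ (L : EuclideanSpace ℝ (Fin n) → ℝ) (ψ : SchwartzMap (EuclideanSpace ℝ (Fin n)) ℝ),
      Integrable L → Integrable (fun w => L (x - w) * ψ w) := fun L ψ hL =>
    (hL.comp_sub_left x).mul_bdd (c := SchwartzMap.seminorm ℝ 0 0 ψ)
      ψ.continuous.aestronglyMeasurable
      (Filter.Eventually.of_forall fun w => ψ.norm_le_seminorm ℝ _)
  have := integral_bilinear_hasLineDerivAt_right_eq_neg_left_of_integrable (μ := volume)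
    (f := fun w => K (x - w)) (f' := fun w => - K' (x - w)) (g := φ) (g' := fun w => (∂_{v} φ) w)
    (v := v) (B := ContinuousLinearMap.mul ℝ ℝ) ?_ ?_ ?_ ?_ ?_
  · simpa [integral_neg] using this
  · simpa using (hi K' φ hKi').neg
  · simpa using hi K _ hKi
  · simpa using hi K _ hKi
  · intro w _
    have h := hd (x - w)
    unfold HasLineDerivAt at h ⊢
    have h2 := HasDerivAt.comp (h₂ := fun s : ℝ => K (x - w + s • v)) (h₂' := K' (x - w)) (0 : ℝ)
      (by simpa using h) (hasDerivAt_neg (0 : ℝ))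
    have e : (fun s : ℝ => K (x - (w + s • v))) = (fun s : ℝ => K (x - w + s • v)) ∘ Neg.neg := by
      ext s
      simp only [Function.comp]
      congr 1
      rw [neg_smul]; abel
    rw [e]
    simpa using h2
  · intro w _
    rw [SchwartzMap.lineDerivOp_apply_eq_fderiv]
    exact (φ.differentiableAt.hasFDerivAt).hasLineDerivAt v

/-- The heat kernel. -/
noncomputable def auxK (n : ℕ) (t : ℝ) (y : EuclideanSpace ℝ (Fin n)) : ℝ :=
  (4 * Real.pi * t) ^ (-(n : ℝ) / 2) * Real.exp (-‖y‖ ^ 2 / (4 * t))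

/-- First derivative of the heat kernel. -/
noncomputable def auxK1 (n : ℕ) (t : ℝ) (i : Fin n) (y : EuclideanSpace ℝ (Fin n)) : ℝ :=
  -(y i) / (2 * t) * auxK n t y

/-- Second derivative of the heat kernel. -/
noncomputable def auxK2 (n : ℕ) (t : ℝ) (i : Fin n) (y : EuclideanSpace ℝ (Fin n)) : ℝ :=
  ((y i) ^ 2 / (4 * t ^ 2) - 1 / (2 * t)) * auxK n t y

/-- The dominating Gaussian. -/
noncomputable def auxG (n : ℕ) (t : ℝ) (y : EuclideanSpace ℝ (Fin n)) : ℝ :=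
  (4 * Real.pi * t) ^ (-(n : ℝ) / 2) * Real.exp (-‖y‖ ^ 2 / (8 * t))

theorem auxG_nonneg (n : ℕ) (t : ℝ) (ht : 0 < t) (y) : 0 ≤ auxG n t y := by
  unfold auxG; positivity

theorem auxK_nonneg (n : ℕ) (t : ℝ) (ht : 0 < t) (y) : 0 ≤ auxK n t y := by
  unfold auxK; positivity

theorem auxK_cont (n : ℕ) (t : ℝ) : Continuous (auxK n t) := by
  unfold auxK; fun_prop

theorem auxG_cont (n : ℕ) (t : ℝ) : Continuous (auxG n t) := by
  unfold auxG; fun_prop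

theorem auxK1_cont (n : ℕ) (t : ℝ) (i) : Continuous (auxK1 n t i) := by
  have := auxK_cont n t
  unfold auxK1; fun_prop

theorem auxK2_cont (n : ℕ) (t : ℝ) (i) : Continuous (auxK2 n t i) := by
  have := auxK_cont n t
  unfold auxK2; fun_prop

theorem auxG_integral (n : ℕ) (t : ℝ) (ht : 0 < t) : ∫ y, auxG n t y = 2 ^ ((n : ℝ) / 2) := by
  have h := GaussianFourier.integral_rexp_neg_mul_sq_norm (V := EuclideanSpace ℝ (Fin n))
    (b := 1 / (8 * t)) (by positivity)
  have e : ∀ y : EuclideanSpace ℝ (Fin n), -‖y‖ ^ 2 / (8 * t) = - (1 / (8 * t)) * ‖y‖ ^ 2 := by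
    intro y; ring
  unfold auxG
  simp_rw [e]
  rw [integral_const_mul, h, finrank_euclideanSpace, Fintype.card_fin]
  have e2 : Real.pi / (1 / (8 * t)) = 2 * (4 * Real.pi * t) := by field_simp; ring
  have hpos : 0 < 4 * Real.pi * t := by positivity
  rw [e2, Real.mul_rpow (by norm_num) hpos.le, mul_left_comm, ← Real.rpow_add hpos]
  ring_nf; simp

theorem auxG_integrable (n : ℕ) (t : ℝ) (ht : 0 < t) : Integrable (auxG n t) := by
  by_contra h
  have := auxG_integral n t ht
  rw [integral_undef h] at this
  have h2 : (0:ℝ) < 2 ^ ((n : ℝ) / 2) := by positivity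
  linarith

theorem auxG_lintegral (n : ℕ) (t : ℝ) (ht : 0 < t) :
    ∫⁻ y, ‖auxG n t y‖ₑ = ENNReal.ofReal (2 ^ ((n : ℝ) / 2)) := by
  rw [← auxG_integral n t ht,
    ofReal_integral_eq_lintegral_ofReal (auxG_integrable n t ht)
      (Filter.Eventually.of_forall (auxG_nonneg n t ht))]
  congr 1; ext y
  exact Real.enorm_eq_ofReal (auxG_nonneg n t ht y)

theorem auxK_eq (n : ℕ) (t : ℝ) (y) :
    auxK n t y = Real.exp (-‖y‖ ^ 2 / (8 * t)) * auxG n t y := by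
  unfold auxK auxG
  rw [mul_left_comm, ← Real.exp_add]
  congr 2; ring

theorem aux_exp (n : ℕ) (t : ℝ) (y : EuclideanSpace ℝ (Fin n)) :
    (1 + ‖y‖ ^ 2 / (8 * t)) * Real.exp (-‖y‖ ^ 2 / (8 * t)) ≤ 1 := by
  have h := Real.add_one_le_exp (‖y‖ ^ 2 / (8 * t))
  rw [neg_div, Real.exp_neg, ← div_eq_mul_inv, div_le_one (Real.exp_pos _)]
  linarith

theorem auxK_le (n : ℕ) (t : ℝ) (ht : 0 < t) (y) : |auxK n t y| ≤ 1 * auxG n t y := by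
  rw [abs_of_nonneg (auxK_nonneg n t ht y), auxK_eq]
  gcongr
  · exact auxG_nonneg n t ht y
  · rw [Real.exp_le_one_iff, neg_div]
    have : 0 ≤ ‖y‖ ^ 2 / (8 * t) := by positivity
    linarith

theorem aux_coord (n : ℕ) (i : Fin n) (y : EuclideanSpace ℝ (Fin n)) : |y i| ≤ ‖y‖ := by
  simpa using PiLp.norm_apply_le y i

theorem auxK1_le (n : ℕ) (t : ℝ) (ht : 0 < t) (i) (y) :
    |auxK1 n t i y| ≤ t ^ (-(1 / 2) : ℝ) * auxG n t y := by
  unfold auxK1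
  rw [abs_mul, abs_of_nonneg (auxK_nonneg n t ht y), auxK_eq, ← mul_assoc]
  refine mul_le_mul_of_nonneg_right ?_ (auxG_nonneg n t ht y)
  have hc := aux_coord n i y
  have he := aux_exp n t y
  have hE := Real.exp_pos (-‖y‖ ^ 2 / (8 * t))
  have hs : 0 < √t := Real.sqrt_pos.2 ht
  have hss : √t * √t = t := Real.mul_self_sqrt ht.le
  have hpow : t ^ (-(1 / 2) : ℝ) = 1 / √t := by
    rw [Real.rpow_neg ht.le, Real.sqrt_eq_rpow]; simp only [one_div]
  have h1 : |-(y i) / (2 * t)| ≤ (1 / √t) * (1 + ‖y‖ ^ 2 / (8 * t)) := by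
    rw [abs_div, abs_neg, abs_of_pos (by positivity : 0 < 2 * t), div_le_iff₀ (by positivity)]
    have e : (1 / √t) * (1 + ‖y‖ ^ 2 / (8 * t)) * (2 * t) = 2 * √t + (‖y‖ / √t) * (‖y‖ / 4) := by
      field_simp
      nlinarith
    rw [e]
    have e3 : ‖y‖ = √t * (‖y‖ / √t) := by field_simp
    have h0 : 0 ≤ ‖y‖ / √t := by positivity
    set s := ‖y‖ / √t
    rw [e3] at hc ⊢
    nlinarith [sq_nonneg (s - 2)]
  rw [hpow]
  calc _ ≤ (1 / √t) * (1 + ‖y‖ ^ 2 / (8 * t)) * Real.exp (-‖y‖ ^ 2 / (8 * t)) := by gcongr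
    _ = (1 / √t) * ((1 + ‖y‖ ^ 2 / (8 * t)) * Real.exp (-‖y‖ ^ 2 / (8 * t))) := by ring
    _ ≤ (1 / √t) * 1 := by gcongr
    _ = _ := by ring

theorem auxK2_le (n : ℕ) (t : ℝ) (ht : 0 < t) (i) (y) :
    |auxK2 n t i y| ≤ (2 * t ^ (-1 : ℝ)) * auxG n t y := by
  unfold auxK2
  rw [abs_mul, abs_of_nonneg (auxK_nonneg n t ht y), auxK_eq, ← mul_assoc]
  refine mul_le_mul_of_nonneg_right ?_ (auxG_nonneg n t ht y)
  have hc := aux_coord n i y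
  have he := aux_exp n t y
  have hE := Real.exp_pos (-‖y‖ ^ 2 / (8 * t))
  have h1 : |(y i) ^ 2 / (4 * t ^ 2) - 1 / (2 * t)| ≤ (2 * t⁻¹) * (1 + ‖y‖ ^ 2 / (8 * t)) := by
    have h2 : (y i) ^ 2 ≤ ‖y‖ ^ 2 := by rw [← sq_abs]; gcongr
    have h3 : (y i) ^ 2 / (4 * t ^ 2) ≤ ‖y‖ ^ 2 / (4 * t ^ 2) := by gcongr
    have h4 : 0 ≤ (y i) ^ 2 / (4 * t ^ 2) := by positivity
    have h5 : 0 < t⁻¹ := by positivity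
    have e : (2 * t⁻¹) * (1 + ‖y‖ ^ 2 / (8 * t)) = 2 * t⁻¹ + ‖y‖ ^ 2 / (4 * t ^ 2) := by
      field_simp; ring
    have e2 : 1 / (2 * t) = t⁻¹ / 2 := by field_simp
    rw [e, e2, abs_le]
    constructor <;> linarith
  rw [Real.rpow_neg_one]
  calc _ ≤ (2 * t⁻¹) * (1 + ‖y‖ ^ 2 / (8 * t)) * Real.exp (-‖y‖ ^ 2 / (8 * t)) := by gcongr
    _ = (2 * t⁻¹) * ((1 + ‖y‖ ^ 2 / (8 * t)) * Real.exp (-‖y‖ ^ 2 / (8 * t))) := by ring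
    _ ≤ (2 * t⁻¹) * 1 := by gcongr
    _ = _ := by ring

theorem aux_integrable (n : ℕ) (t c : ℝ) (ht : 0 < t) (L : EuclideanSpace ℝ (Fin n) → ℝ)
    (hL : Continuous L) (h : ∀ y, |L y| ≤ c * auxG n t y) : Integrable L :=
  ((auxG_integrable n t ht).const_mul c).mono' hL.aestronglyMeasurable
    (Filter.Eventually.of_forall h)

theorem auxK_deriv (n : ℕ) (t : ℝ) (ht : 0 < t) (i) (y) :
    HasLineDerivAt ℝ (auxK n t) (auxK1 n t i y) y (EuclideanSpace.single i 1) := by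
  unfold HasLineDerivAt auxK1 auxK
  have e : ∀ s : ℝ, ‖y + s • EuclideanSpace.single i (1:ℝ)‖ ^ 2 = ‖y‖ ^ 2 + 2 * s * y i + s ^ 2 := by
    intro s
    rw [norm_add_sq_real, norm_smul, inner_smul_right]
    simp [EuclideanSpace.inner_single_right]
    ring
  simp_rw [e]
  have h0 : HasDerivAt (fun s : ℝ => -(‖y‖ ^ 2 + 2 * s * y i + s ^ 2) / (4 * t))
      (-(2 * y i) / (4 * t)) 0 := by
    have h := (((((hasDerivAt_id (0:ℝ)).const_mul (2 * y i)).const_add (‖y‖^2)).add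
      ((hasDerivAt_id (0:ℝ)).pow 2)).neg).div_const (4 * t)
    simp at h
    refine (h.congr_deriv ?_).congr_of_eventuallyEq (Filter.Eventually.of_forall fun s => ?_)
    · simp
    · simp; ring
  refine (h0.exp.const_mul _).congr_deriv ?_
  simp
  field_simp
  ring

theorem auxK1_deriv (n : ℕ) (t : ℝ) (ht : 0 < t) (i) (y) :
    HasLineDerivAt ℝ (auxK1 n t i) (auxK2 n t i y) y (EuclideanSpace.single i 1) := by
  have hK := auxK_deriv n t ht i y
  unfold HasLineDerivAt at hK ⊢
  unfold auxK1 auxK2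
  have h0 : HasDerivAt (fun s : ℝ => -((y + s • EuclideanSpace.single i (1:ℝ)) i) / (2 * t))
      (-1 / (2 * t)) 0 := by
    have h := (((hasDerivAt_id (0:ℝ)).const_add (y i)).neg).div_const (2 * t)
    refine h.congr_of_eventuallyEq (Filter.Eventually.of_forall fun s => ?_)
    simp
  refine (h0.mul hK).congr_deriv ?_
  unfold auxK1
  simp
  field_simp
  ring

theorem aux_enorm (n : ℕ) (t c : ℝ) (ht : 0 < t) (hc : 0 ≤ c)
    (L ψ g : EuclideanSpace ℝ (Fin n) → ℝ)
    (h : ∀ y, |L y| ≤ c * auxG n t y) (hg : ∀ y, |ψ y| ≤ |g y|) (x) :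
    ‖∫ w, L (x - w) * ψ w‖ₑ ≤ ENNReal.ofReal c * ∫⁻ w, ‖auxG n t (x - w)‖ₑ * ‖g w‖ₑ := by
  refine (enorm_integral_le_lintegral_enorm _).trans ?_
  rw [← lintegral_const_mul' _ _ ENNReal.ofReal_ne_top]
  refine lintegral_mono fun w => ?_
  simp only
  rw [enorm_mul, ← mul_assoc]
  gcongr ?_ * ?_
  · rw [Real.enorm_eq_ofReal (auxG_nonneg n t ht _), ← ENNReal.ofReal_mul hc,
      Real.enorm_eq_ofReal_abs]
    exact ENNReal.ofReal_le_ofReal (h _)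
  · rw [Real.enorm_eq_ofReal_abs, Real.enorm_eq_ofReal_abs]
    exact ENNReal.ofReal_le_ofReal (hg _)

theorem aux_laplacian (n : ℕ) (t : ℝ) (ht : 0 < t)
    (f : SchwartzMap (EuclideanSpace ℝ (Fin n)) ℝ) (i : Fin n) (x : EuclideanSpace ℝ (Fin n)) :
    fderiv ℝ (fun y : EuclideanSpace ℝ (Fin n) =>
                fderiv ℝ (fun z : EuclideanSpace ℝ (Fin n) =>
                  ∫ w : EuclideanSpace ℝ (Fin n),
                    (4 * Real.pi * t) ^ (-(n : ℝ) / 2) *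
                      Real.exp (-‖z - w‖ ^ 2 / (4 * t)) * f w)
                  y (EuclideanSpace.single i 1))
              x (EuclideanSpace.single i 1) =
    ∫ w, auxK1 n t i (x - w) * (∂_{EuclideanSpace.single i (1:ℝ)} f) w := by
  have hKi := aux_integrable n t _ ht _ (auxK_cont n t) (auxK_le n t ht)
  have hKi1 := aux_integrable n t _ ht _ (auxK1_cont n t i) (auxK1_le n t ht i)
  have h1 := fun y => aux_diff (auxK n t) (auxK_cont n t) hKi f y (EuclideanSpace.single i 1)
  have h2 := aux_diff (auxK n t) (auxK_cont n t) hKi (∂_{EuclideanSpace.single i (1:ℝ)} f) x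
    (EuclideanSpace.single i 1)
  rw [← aux_ibp (auxK n t) (auxK1 n t i) hKi hKi1 _ x (EuclideanSpace.single i 1)
    (auxK_deriv n t ht i), ← h2]
  simp_rw [← h1]
  rfl

theorem aux_laplacian2 (n : ℕ) (t : ℝ) (ht : 0 < t)
    (f : SchwartzMap (EuclideanSpace ℝ (Fin n)) ℝ) (i : Fin n) (x : EuclideanSpace ℝ (Fin n)) :
    ∫ w, auxK1 n t i (x - w) * (∂_{EuclideanSpace.single i (1:ℝ)} f) w =
    ∫ w, auxK2 n t i (x - w) * f w :=
  aux_ibp _ _ (aux_integrable n t _ ht _ (auxK1_cont n t i) (auxK1_le n t ht i))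
    (aux_integrable n t _ ht _ (auxK2_cont n t i) (auxK2_le n t ht i)) _ x _
    (auxK1_deriv n t ht i)

theorem aux_norm (n : ℕ) (t c p : ℝ) (ht : 0 < t) (hc : 0 ≤ c) (hp : 1 ≤ p)
    (F : Fin n → EuclideanSpace ℝ (Fin n) → ℝ)
    (g : EuclideanSpace ℝ (Fin n) → ℝ) (hg : Continuous g)
    (hgp : eLpNorm g (ENNReal.ofReal p) volume ≠ ⊤)
    (hF : ∀ i x, ‖F i x‖ₑ ≤ ENNReal.ofReal c * ∫⁻ w, ‖auxG n t (x - w)‖ₑ * ‖g w‖ₑ) :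
    (eLpNorm (fun x => ∑ i, F i x) (ENNReal.ofReal p) volume).toReal ≤
      n * c * 2 ^ ((n : ℝ) / 2) * (eLpNorm g (ENNReal.ofReal p) volume).toReal := by
  have h := aux_young p hp (auxG n t) g (auxG_cont n t) hg (fun x => ∑ i, F i x)
    (n * ENNReal.ofReal c) (fun x => by
      refine (enorm_sum_le _ _).trans ?_
      refine (Finset.sum_le_sum fun i _ => hF i x).trans ?_
      simp [mul_assoc])
  rw [auxG_lintegral n t ht] at h
  have h2 := ENNReal.toReal_mono (by finiteness) h
  simp only [ENNReal.toReal_mul, ENNReal.toReal_natCast, ENNReal.toReal_ofReal hc] at h2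
  rwa [ENNReal.toReal_ofReal (by positivity)] at h2

theorem aux_calc (σ M A B : ℝ) (hσ0 : 0 < σ) (hσ1 : σ < 1) (hM : 0 ≤ M) (hA : 0 ≤ A) (hB : 0 ≤ B)
    (N : ℝ → ℝ) (hN : ∀ t, 0 ≤ N t) (h1 : ∀ t > 0, N t ≤ M * A * t ^ (-1 : ℝ))
    (h2 : ∀ t > 0, N t ≤ M * B * t ^ (-(1 / 2) : ℝ)) :
    ∫ t in Set.Ioi (0 : ℝ), t ^ (-σ / 2) * N t ≤
      M * (2 / (1 - σ) + 2 / σ) * A ^ (1 - σ) * B ^ σ := by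
  have hs : 0 < 1 - σ := by linarith
  by_cases hz : A = 0 ∨ B = 0
  · have : ∀ t ∈ Set.Ioi (0:ℝ), t ^ (-σ / 2) * N t = 0 := by
      intro t ht
      have : N t ≤ 0 := by
        rcases hz with rfl | rfl
        · simpa using h1 t ht
        · simpa using h2 t ht
      rw [le_antisymm this (hN t), mul_zero]
    rw [setIntegral_congr_fun measurableSet_Ioi this]
    simp only [integral_zero]
    positivity
  push Not at hz
  have hA' : 0 < A := lt_of_le_of_ne hA hz.1.symm
  have hB' : 0 < B := lt_of_le_of_ne hB hz.2.symm
  set T := (A / B) ^ (2 : ℝ) with hT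
  have hTpos : 0 < T := by positivity
  set g : ℝ → ℝ := fun t => if t ≤ T then M * B * t ^ (-(1 + σ) / 2) else M * A * t ^ (-1 - σ / 2)
    with hg
  have hgl : Set.EqOn g (fun t => M * B * t ^ (-(1 + σ) / 2)) (Set.Ioc 0 T) := by
    intro t ht; simp [hg, ht.2]
  have hgr : Set.EqOn g (fun t => M * A * t ^ (-1 - σ / 2)) (Set.Ioi T) := by
    intro t ht
    have : ¬ t ≤ T := not_le.2 ht
    simp [hg, this]
  have hil : IntegrableOn g (Set.Ioc 0 T) := by
    refine IntegrableOn.congr_fun ?_ hgl.symm measurableSet_Ioc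
    refine Integrable.const_mul ?_ _
    exact (intervalIntegrable_iff_integrableOn_Ioc_of_le hTpos.le).1
      (intervalIntegral.intervalIntegrable_rpow' (by linarith))
  have hir : IntegrableOn g (Set.Ioi T) := by
    refine IntegrableOn.congr_fun ?_ hgr.symm measurableSet_Ioi
    refine Integrable.const_mul ?_ _
    exact integrableOn_Ioi_rpow_of_lt (by linarith) hTpos
  have hU : Set.Ioc 0 T ∪ Set.Ioi T = Set.Ioi 0 := Set.Ioc_union_Ioi_eq_Ioi hTpos.le
  have hle : ∫ t in Set.Ioi (0 : ℝ), t ^ (-σ / 2) * N t ≤ ∫ t in Set.Ioi (0 : ℝ), g t := by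
    refine integral_mono_of_nonneg ?_ ?_ ?_
    · refine (ae_restrict_iff' measurableSet_Ioi).2 (Filter.Eventually.of_forall fun t ht => ?_)
      have := hN t
      have : 0 < t := ht
      simp only [Pi.zero_apply]
      positivity
    · rw [← hU]; exact hil.union hir
    · refine (ae_restrict_iff' measurableSet_Ioi).2 (Filter.Eventually.of_forall fun t ht => ?_)
      have ht : 0 < t := ht
      have hp : 0 ≤ t ^ (-σ / 2) := by positivity
      simp only [hg]
      split_ifs
      · refine (mul_le_mul_of_nonneg_left (h2 t ht) hp).trans (le_of_eq ?_)
        rw [mul_left_comm, ← Real.rpow_add ht]; congr 2; ring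
      · refine (mul_le_mul_of_nonneg_left (h1 t ht) hp).trans (le_of_eq ?_)
        rw [mul_left_comm, ← Real.rpow_add ht]; congr 2; ring
  refine hle.trans (le_of_eq ?_)
  rw [← hU, setIntegral_union (Set.Ioc_disjoint_Ioi le_rfl) measurableSet_Ioi hil hir,
    setIntegral_congr_fun measurableSet_Ioc hgl, setIntegral_congr_fun measurableSet_Ioi hgr,
    integral_const_mul, integral_const_mul, integral_Ioi_rpow_of_lt (by linarith) hTpos,
    ← intervalIntegral.integral_of_le hTpos.le, integral_rpow (Or.inl (by linarith))]
  have e1 : -(1 + σ) / 2 + 1 = (1 - σ) / 2 := by ring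
  have e2 : -1 - σ / 2 + 1 = -σ / 2 := by ring
  have hq : 0 ≤ A / B := by positivity
  rw [e1, e2, Real.zero_rpow (by linarith), hT, ← Real.rpow_mul hq, ← Real.rpow_mul hq]
  have e3 : 2 * ((1 - σ) / 2) = 1 - σ := by ring
  have e4 : 2 * (-σ / 2) = - σ := by ring
  rw [e3, e4, Real.div_rpow hA hB, Real.div_rpow hA hB]
  have a1 : A ^ (-σ) = A ^ (1 - σ) / A := by
    rw [← Real.rpow_sub_one hA'.ne']; congr 1; ring
  have b1 : B ^ (1 - σ) = B / B ^ σ := by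
    rw [Real.rpow_sub hB', Real.rpow_one]
  have b2 : B ^ (-σ) = 1 / B ^ σ := by
    rw [Real.rpow_neg hB, one_div]
  rw [a1, b1, b2]
  have : 0 < B ^ σ := by positivity
  field_simp
  ring

theorem aux_bound1 (n : ℕ) (t p : ℝ) (ht : 0 < t) (hp : 1 ≤ p)
    (f : SchwartzMap (EuclideanSpace ℝ (Fin n)) ℝ) :
    (eLpNorm (fun x => ∑ i, ∫ w, auxK1 n t i (x - w) * (∂_{EuclideanSpace.single i (1:ℝ)} f) w)
      (ENNReal.ofReal p) volume).toReal ≤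
      n * (2 * t ^ (-1 : ℝ)) * 2 ^ ((n : ℝ) / 2) *
        (eLpNorm (⇑f) (ENNReal.ofReal p) volume).toReal := by
  simp_rw [aux_laplacian2 n t ht]
  refine aux_norm n t (2 * t ^ (-1 : ℝ)) p ht (by positivity) hp
    (fun i x => ∫ w, auxK2 n t i (x - w) * f w) (⇑f) f.continuous
    (f.memLp (ENNReal.ofReal p) volume).eLpNorm_ne_top ?_
  intro i x
  exact aux_enorm n t (2 * t ^ (-1 : ℝ)) ht (by positivity) (auxK2 n t i) (⇑f) (⇑f)
    (auxK2_le n t ht i) (fun y => le_rfl) x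

theorem aux_coe (n : ℕ) (f : SchwartzMap (EuclideanSpace ℝ (Fin n)) ℝ) :
    ⇑(SchwartzMap.fderivCLM ℝ (EuclideanSpace ℝ (Fin n)) ℝ f) = fun x => fderiv ℝ (⇑f) x :=
  funext fun x => SchwartzMap.fderivCLM_apply ℝ f x

theorem aux_fcont (n : ℕ) (f : SchwartzMap (EuclideanSpace ℝ (Fin n)) ℝ) :
    Continuous (fun x => ‖fderiv ℝ (⇑f) x‖) := by
  have h := (SchwartzMap.fderivCLM ℝ (EuclideanSpace ℝ (Fin n)) ℝ f).continuous
  rw [aux_coe] at h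
  exact h.norm

theorem aux_fin (n : ℕ) (p : ℝ) (f : SchwartzMap (EuclideanSpace ℝ (Fin n)) ℝ) :
    eLpNorm (fun x => ‖fderiv ℝ (⇑f) x‖) (ENNReal.ofReal p) volume ≠ ⊤ := by
  have h := (SchwartzMap.fderivCLM ℝ (EuclideanSpace ℝ (Fin n)) ℝ f).memLp
      (ENNReal.ofReal p) volume
  rw [aux_coe] at h
  exact h.norm.eLpNorm_ne_top

theorem aux_bound2 (n : ℕ) (t p : ℝ) (ht : 0 < t) (hp : 1 ≤ p)
    (f : SchwartzMap (EuclideanSpace ℝ (Fin n)) ℝ) :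
    (eLpNorm (fun x => ∑ i, ∫ w, auxK1 n t i (x - w) * (∂_{EuclideanSpace.single i (1:ℝ)} f) w)
      (ENNReal.ofReal p) volume).toReal ≤
      n * (t ^ (-(1 / 2) : ℝ)) * 2 ^ ((n : ℝ) / 2) *
        (eLpNorm (fun x => ‖fderiv ℝ (⇑f) x‖) (ENNReal.ofReal p) volume).toReal := by
  have hfin := aux_fin n p f
  have hcont := aux_fcont n f
  have hle : ∀ (i : Fin n) (y : EuclideanSpace ℝ (Fin n)),
      |(∂_{EuclideanSpace.single i (1:ℝ)} f) y| ≤ |(fun x => ‖fderiv ℝ (⇑f) x‖) y| := by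
    intro i y
    show _ ≤ |‖fderiv ℝ (⇑f) y‖|
    rw [SchwartzMap.lineDerivOp_apply_eq_fderiv, abs_norm, ← Real.norm_eq_abs]
    have h := (fderiv ℝ f y).le_opNorm (EuclideanSpace.single i (1:ℝ))
    have h1 : ‖EuclideanSpace.single i (1:ℝ)‖ = 1 := by simp
    rwa [h1, mul_one] at h
  generalize (fun x => ‖fderiv ℝ (⇑f) x‖) = g at *
  refine aux_norm n t (t ^ (-(1 / 2) : ℝ)) p ht (by positivity) hp _ g hcont hfin ?_
  intro i x
  exact aux_enorm n t (t ^ (-(1 / 2) : ℝ)) ht (by positivity) (auxK1 n t i) _ g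
    (auxK1_le n t ht i) (hle i) x

/-- **Interpolation estimate for the heat-semigroup representation of the
fractional Laplacian (`L^p`, `0 < σ < 1`):** for every Schwartz function `f`,
`(1/Γ(1−σ/2)) ∫₀^∞ t^{−σ/2} ‖Δ(h_t ∗ f)‖_{L^p} dt ≤ C ‖f‖_{L^p}^{1−σ} ‖∇f‖_{L^p}^{σ}`. -/
theorem heat_semigroup_fractional_laplacian_interpolation_Lp
    (n : ℕ) (hn : 1 ≤ n) (p σ : ℝ) (hp : 1 ≤ p) (hσ0 : 0 < σ) (hσ1 : σ < 1) :
    ∃ C > 0, ∀ f : SchwartzMap (EuclideanSpace ℝ (Fin n)) ℝ,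
      (1 / Real.Gamma (1 - σ / 2)) *
        ∫ t in Set.Ioi (0 : ℝ), t ^ (-σ / 2) *
          (eLpNorm (fun x : EuclideanSpace ℝ (Fin n) =>
            ∑ i : Fin n, fderiv ℝ (fun y : EuclideanSpace ℝ (Fin n) =>
                fderiv ℝ (fun z : EuclideanSpace ℝ (Fin n) =>
                  ∫ w : EuclideanSpace ℝ (Fin n),
                    (4 * Real.pi * t) ^ (-(n : ℝ) / 2) *
                      Real.exp (-‖z - w‖ ^ 2 / (4 * t)) * f w)
                  y (EuclideanSpace.single i 1))
              x (EuclideanSpace.single i 1)) (ENNReal.ofReal p) volume).toReal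
      ≤ C * (eLpNorm (⇑f) (ENNReal.ofReal p) volume).toReal ^ (1 - σ) *
          (eLpNorm (fun x : EuclideanSpace ℝ (Fin n) => ‖fderiv ℝ (⇑f) x‖)
            (ENNReal.ofReal p) volume).toReal ^ σ := by
  have hn0 : (0:ℝ) < n := by exact_mod_cast hn
  have hG : 0 < Real.Gamma (1 - σ / 2) := Real.Gamma_pos_of_pos (by linarith)
  have hs : 0 < 1 - σ := by linarith
  set M : ℝ := n * 2 * 2 ^ ((n : ℝ) / 2) with hM
  have hMpos : 0 < M := by positivity
  refine ⟨(1 / Real.Gamma (1 - σ / 2)) * (M * (2 / (1 - σ) + 2 / σ)), by positivity, fun f => ?_⟩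
  rw [mul_assoc _ _ (_ ^ σ), mul_assoc (1 / _)]
  refine mul_le_mul_of_nonneg_left ?_ (by positivity)
  rw [← mul_assoc]
  refine aux_calc σ M _ _ hσ0 hσ1 hMpos.le ENNReal.toReal_nonneg ENNReal.toReal_nonneg _
    (fun t => ENNReal.toReal_nonneg) (fun t ht => ?_) (fun t ht => ?_)
  · simp_rw [aux_laplacian n t ht]
    refine (aux_bound1 n t p ht hp f).trans (le_of_eq ?_)
    rw [hM]; ring
  · simp_rw [aux_laplacian n t ht]
    refine (aux_bound2 n t p ht hp f).trans ?_
    have hB : 0 ≤ (eLpNorm (fun x => ‖fderiv ℝ (⇑f) x‖) (ENNReal.ofReal p) volume).toReal :=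
      ENNReal.toReal_nonneg
    generalize (eLpNorm (fun x => ‖fderiv ℝ (⇑f) x‖) (ENNReal.ofReal p) volume).toReal = B at hB ⊢
    have : 0 ≤ n * t ^ (-(1 / 2) : ℝ) * 2 ^ ((n : ℝ) / 2) * B := by
      have : 0 < t := ht
      positivity
    rw [hM]
    linarith
end

section
/- Let n ≥ 1 and 0 < σ < 2. There exists a constant C > 0, depending only on n and σ, such that for every Schwartz function f : ℝⁿ → ℝ one has (1/Γ(1−σ/2)) ∫₀^{+∞} t^{−σ/2} ‖Δ(h_t ∗ f)‖_{L^1(ℝⁿ)} dt ≤ C ‖f‖_{L^1(ℝⁿ)}^{1−σ/2} ‖Δf‖_{L^1(ℝⁿ)}^{σ/2}, where h_t ∗ f denotes convolution with the Gaussian heat kernel and Δ is the Laplacian in the space variable. -/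
open MeasureTheory

section helpers
variable {n : ℕ}

lemma hs_conv_fderiv (φ ψ : EuclideanSpace ℝ (Fin n) → ℝ) (hφ : ContDiff ℝ 1 φ)
    (M0 M1 : ℝ) (h0 : ∀ x, ‖φ x‖ ≤ M0) (h1 : ∀ x, ‖fderiv ℝ φ x‖ ≤ M1)
    (hψ : Integrable ψ volume) (z v : EuclideanSpace ℝ (Fin n)) :
    fderiv ℝ (fun z => ∫ w, φ (z - w) * ψ w) z v = ∫ w, fderiv ℝ φ (z - w) v * ψ w := by
  have hc := hφ.continuous
  have hc' : Continuous (fderiv ℝ φ) := hφ.continuous_fderiv (by norm_num)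
  have hm : ∀ z, AEStronglyMeasurable (fun w => φ (z - w) * ψ w) volume := fun z =>
    (hc.comp (continuous_const.sub continuous_id)).aestronglyMeasurable.mul
      hψ.aestronglyMeasurable
  have hm' : AEStronglyMeasurable (fun w => ψ w • fderiv ℝ φ (z - w)) volume :=
    hψ.aestronglyMeasurable.smul
      (hc'.comp (continuous_const.sub continuous_id)).aestronglyMeasurable
  have hb : Integrable (fun w => M1 * ‖ψ w‖) volume := hψ.norm.const_mul M1
  have hle : ∀ (x w : EuclideanSpace ℝ (Fin n)),
      ‖ψ w • fderiv ℝ φ (x - w)‖ ≤ M1 * ‖ψ w‖ := by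
    intro x w
    rw [norm_smul, mul_comm]
    exact mul_le_mul_of_nonneg_right (h1 _) (norm_nonneg _)
  have key := hasFDerivAt_integral_of_dominated_of_fderiv_le (𝕜 := ℝ) (μ := volume)
    (F := fun z w => φ (z - w) * ψ w) (F' := fun z w => ψ w • fderiv ℝ φ (z - w))
    (x₀ := z) (s := Set.univ) (bound := fun w => M1 * ‖ψ w‖) Filter.univ_mem
    (Filter.Eventually.of_forall hm)
    ((hψ.norm.const_mul M0).mono' (hm z) (Filter.Eventually.of_forall fun w => by
      rw [norm_mul]
      exact mul_le_mul_of_nonneg_right (h0 _) (norm_nonneg _)))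
    hm' (Filter.Eventually.of_forall fun w x _ => hle x w) hb
    (Filter.Eventually.of_forall fun w x _ => by
      have hd : HasFDerivAt φ (fderiv ℝ φ (x - w)) (x - w) :=
        (hφ.differentiable (by norm_num) (x - w)).hasFDerivAt
      have := (hd.comp x ((hasFDerivAt_id x).sub_const w)).mul_const (ψ w)
      simpa using this)
  rw [key.fderiv, ContinuousLinearMap.integral_apply]
  · simp [mul_comm]
  · exact hb.mono' hm' (Filter.Eventually.of_forall fun w => hle z w)

lemma hs_conv_lap (φ ψ : EuclideanSpace ℝ (Fin n) → ℝ) (hφ : ContDiff ℝ 2 φ)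
    (M0 M1 M2 : ℝ) (h0 : ∀ x, ‖φ x‖ ≤ M0) (h1 : ∀ x, ‖fderiv ℝ φ x‖ ≤ M1)
    (h2 : ∀ (i : Fin n) x, ‖fderiv ℝ (fun y => fderiv ℝ φ y (EuclideanSpace.single i 1)) x‖ ≤ M2)
    (hψ : Integrable ψ volume) (x : EuclideanSpace ℝ (Fin n)) :
    ∑ i : Fin n, fderiv ℝ (fun y => fderiv ℝ (fun z => ∫ w, φ (z - w) * ψ w) y
        (EuclideanSpace.single i 1)) x (EuclideanSpace.single i 1)
      = ∫ w, (∑ i : Fin n, fderiv ℝ (fun y => fderiv ℝ φ y (EuclideanSpace.single i 1)) (x - w)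
          (EuclideanSpace.single i 1)) * ψ w := by
  have hd : ∀ v, ContDiff ℝ 1 (fun y => fderiv ℝ φ y v) := fun v =>
    (hφ.fderiv_right (m := 1) (by norm_num)).clm_apply contDiff_const
  simp only [Finset.sum_mul]
  rw [integral_finsetSum]
  · refine Finset.sum_congr rfl fun i _ => ?_
    have e : (fun y => fderiv ℝ (fun z => ∫ w, φ (z - w) * ψ w) y
        (EuclideanSpace.single i 1)) =
        fun y => ∫ w, fderiv ℝ φ (y - w) (EuclideanSpace.single i 1) * ψ w := by
      funext y
      exact hs_conv_fderiv φ ψ (hφ.of_le (by norm_num)) M0 M1 h0 h1 hψ y _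
    rw [e]
    refine hs_conv_fderiv (fun y => fderiv ℝ φ y (EuclideanSpace.single i 1)) ψ (hd _) M1 M2
      (fun y => ?_) (h2 i) hψ x _
    refine ((fderiv ℝ φ y).le_opNorm _).trans ?_
    simpa using h1 y
  · intro i _
    have hc : Continuous (fun w => fderiv ℝ (fun y => fderiv ℝ φ y (EuclideanSpace.single i 1))
        (x - w) (EuclideanSpace.single i 1)) :=
      (((hd _).continuous_fderiv (by norm_num)).comp
        (continuous_const.sub continuous_id)).clm_apply continuous_const
    refine (hψ.norm.const_mul M2).mono' (hc.aestronglyMeasurable.mul hψ.aestronglyMeasurable)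
      (Filter.Eventually.of_forall fun w => ?_)
    rw [norm_mul]
    refine mul_le_mul_of_nonneg_right ?_ (norm_nonneg _)
    refine (ContinuousLinearMap.le_opNorm _ _).trans ?_
    simpa using h2 i (x - w)

lemma hs_young (a b : EuclideanSpace ℝ (Fin n) → ℝ) (ha : Continuous a) (hb : Continuous b) :
    eLpNorm (fun x => ∫ w, a (x - w) * b w) 1 volume
      ≤ eLpNorm a 1 volume * eLpNorm b 1 volume := by
  simp only [eLpNorm_one_eq_lintegral_enorm]
  calc ∫⁻ x, ‖∫ w, a (x - w) * b w‖ₑ ≤ ∫⁻ x, ∫⁻ w, ‖a (x - w)‖ₑ * ‖b w‖ₑ := by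
        refine lintegral_mono fun x => (enorm_integral_le_lintegral_enorm _).trans ?_
        simp [enorm_mul]
    _ = ∫⁻ w, ∫⁻ x, ‖a (x - w)‖ₑ * ‖b w‖ₑ := by
        refine lintegral_lintegral_swap ?_
        have m1 : Measurable (fun p : EuclideanSpace ℝ (Fin n) × EuclideanSpace ℝ (Fin n) =>
            ‖a (p.1 - p.2)‖ₑ) := (ha.comp (continuous_fst.sub continuous_snd)).measurable.enorm
        have m2 : Measurable (fun p : EuclideanSpace ℝ (Fin n) × EuclideanSpace ℝ (Fin n) =>
            ‖b p.2‖ₑ) := (hb.comp continuous_snd).measurable.enorm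
        exact (m1.mul m2).aemeasurable
    _ = ∫⁻ w, (∫⁻ x, ‖a x‖ₑ) * ‖b w‖ₑ := by
        refine lintegral_congr fun w => ?_
        have m1 : Measurable (fun x : EuclideanSpace ℝ (Fin n) => ‖a (x - w)‖ₑ) :=
          (ha.comp (continuous_id.sub continuous_const)).measurable.enorm
        rw [lintegral_mul_const _ m1,
          lintegral_sub_right_eq_self (fun x => ‖a x‖ₑ) w]
    _ = _ := by rw [lintegral_const_mul _ hb.measurable.enorm]

lemma hs_gauss_hasFDerivAt (b : ℝ) (x : EuclideanSpace ℝ (Fin n)) :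
    HasFDerivAt (fun x : EuclideanSpace ℝ (Fin n) => Real.exp (-b * ‖x‖ ^ 2))
      ((Real.exp (-b * ‖x‖ ^ 2) * (-2 * b)) • innerSL ℝ x) x := by
  have h := ((hasStrictFDerivAt_norm_sq x).hasFDerivAt.const_mul (-b)).exp
  refine h.congr_fderiv ?_
  ext v
  simp
  ring

lemma hs_gauss_fderiv2 (b : ℝ) (x v : EuclideanSpace ℝ (Fin n)) :
    HasFDerivAt (fun y => fderiv ℝ
      (fun x : EuclideanSpace ℝ (Fin n) => Real.exp (-b * ‖x‖ ^ 2)) y v)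
      ((Real.exp (-b * ‖x‖ ^ 2) * (-2 * b)) • innerSL ℝ v +
        (inner ℝ v x * (Real.exp (-b * ‖x‖ ^ 2) * (-2 * b) * (-2 * b))) • innerSL ℝ x) x := by
  have e : (fun y => fderiv ℝ
      (fun x : EuclideanSpace ℝ (Fin n) => Real.exp (-b * ‖x‖ ^ 2)) y v) =
      fun y => (Real.exp (-b * ‖y‖ ^ 2) * (-2 * b)) * innerSL ℝ v y := by
    funext y
    rw [(hs_gauss_hasFDerivAt b y).fderiv]
    simp [real_inner_comm]
  rw [e]
  refine (((hs_gauss_hasFDerivAt b x).mul_const (-2 * b)).mul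
    (innerSL ℝ v).hasFDerivAt).congr_fderiv ?_
  ext w
  simp
  ring

lemma hs_gauss_lap (b : ℝ) (x : EuclideanSpace ℝ (Fin n)) :
    ∑ i : Fin n, fderiv ℝ (fun y => fderiv ℝ
      (fun x : EuclideanSpace ℝ (Fin n) => Real.exp (-b * ‖x‖ ^ 2)) y (EuclideanSpace.single i 1))
      x (EuclideanSpace.single i 1)
      = Real.exp (-b * ‖x‖ ^ 2) * (-2 * b * n + 4 * b ^ 2 * ‖x‖ ^ 2) := by
  have : ∀ i : Fin n, fderiv ℝ (fun y => fderiv ℝ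
      (fun x : EuclideanSpace ℝ (Fin n) => Real.exp (-b * ‖x‖ ^ 2)) y (EuclideanSpace.single i 1))
      x (EuclideanSpace.single i 1) = Real.exp (-b * ‖x‖ ^ 2) * (-2 * b) +
        Real.exp (-b * ‖x‖ ^ 2) * (4 * b ^ 2) * x i ^ 2 := by
    intro i
    rw [(hs_gauss_fderiv2 b x _).fderiv]
    simp [EuclideanSpace.inner_single_left, EuclideanSpace.inner_single_right]
    ring
  rw [Finset.sum_congr rfl fun i _ => this i, Finset.sum_add_distrib, ← Finset.mul_sum _ (fun i => x i ^ 2),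
    ← EuclideanSpace.real_norm_sq_eq]
  simp
  ring

lemma hs_gauss_sq_bound (b : ℝ) (hb : 0 < b) (x : EuclideanSpace ℝ (Fin n)) :
    Real.exp (-b * ‖x‖ ^ 2) * ‖x‖ ^ 2 ≤ 1 / b := by
  rw [le_div_iff₀ hb]
  have h1 := Real.add_one_le_exp (b * ‖x‖ ^ 2)
  have h2 : Real.exp (-b * ‖x‖ ^ 2) * Real.exp (b * ‖x‖ ^ 2) = 1 := by
    rw [← Real.exp_add]; simp
  nlinarith [Real.exp_pos (-b * ‖x‖ ^ 2)]

lemma hs_gauss_bounds (b : ℝ) (hb : 0 < b) :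
    (∀ x : EuclideanSpace ℝ (Fin n), ‖Real.exp (-b * ‖x‖ ^ 2)‖ ≤ 1) ∧
    (∀ x : EuclideanSpace ℝ (Fin n), ‖fderiv ℝ
      (fun x : EuclideanSpace ℝ (Fin n) => Real.exp (-b * ‖x‖ ^ 2)) x‖ ≤ 2 * b * (1 + 1 / b)) ∧
    (∀ (i : Fin n) (x : EuclideanSpace ℝ (Fin n)), ‖fderiv ℝ (fun y => fderiv ℝ
      (fun x : EuclideanSpace ℝ (Fin n) => Real.exp (-b * ‖x‖ ^ 2)) y (EuclideanSpace.single i 1))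
      x‖ ≤ 2 * b + 4 * b ^ 2 * (1 / b)) := by
  have hE : ∀ x : EuclideanSpace ℝ (Fin n), Real.exp (-b * ‖x‖ ^ 2) ≤ 1 := fun x => by
    rw [Real.exp_le_one_iff]; nlinarith [sq_nonneg ‖x‖]
  refine ⟨fun x => ?_, fun x => ?_, fun i x => ?_⟩
  · rw [Real.norm_of_nonneg (Real.exp_pos _).le]; exact hE x
  · rw [(hs_gauss_hasFDerivAt b x).fderiv, norm_smul, innerSL_apply_norm, norm_mul,
      Real.norm_of_nonneg (Real.exp_pos _).le]
    have : ‖-2 * b‖ = 2 * b := by rw [norm_mul, Real.norm_of_nonneg hb.le]; norm_num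
    rw [this]
    have h3 := hs_gauss_sq_bound b hb x
    have h4 : Real.exp (-b * ‖x‖ ^ 2) * ‖x‖ ≤ 1 + 1 / b := by
      nlinarith [Real.exp_pos (-b * ‖x‖ ^ 2), hE x, sq_nonneg (‖x‖ - 1), norm_nonneg x,
        mul_nonneg (Real.exp_pos (-b * ‖x‖ ^ 2)).le (sq_nonneg (‖x‖ - 1)),
        mul_nonneg (Real.exp_pos (-b * ‖x‖ ^ 2)).le (sq_nonneg ‖x‖)]
    nlinarith
  · rw [(hs_gauss_fderiv2 b x _).fderiv]
    refine (norm_add_le _ _).trans ?_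
    rw [norm_smul, norm_smul, innerSL_apply_norm, innerSL_apply_norm]
    simp only [norm_mul, Real.norm_of_nonneg (Real.exp_pos _).le, Real.norm_of_nonneg hb.le]
    have h5 : ‖inner ℝ (EuclideanSpace.single i (1:ℝ)) x‖ ≤ ‖x‖ := by
      simpa using norm_inner_le_norm (𝕜 := ℝ) (EuclideanSpace.single i (1:ℝ)) x
    have h3 := hs_gauss_sq_bound b hb x
    have h6 : ‖(-2:ℝ)‖ = 2 := by norm_num
    have h7 : ‖EuclideanSpace.single i (1:ℝ)‖ = 1 := by simp
    rw [h6, h7]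
    refine add_le_add (by nlinarith [hE x]) ?_
    calc _ = ‖inner ℝ (EuclideanSpace.single i (1:ℝ)) x‖ *
          (Real.exp (-b * ‖x‖ ^ 2) * (2 * b) * (2 * b) * ‖x‖) := by ring
      _ ≤ ‖x‖ * (Real.exp (-b * ‖x‖ ^ 2) * (2 * b) * (2 * b) * ‖x‖) := by gcongr
      _ = 4 * b ^ 2 * (Real.exp (-b * ‖x‖ ^ 2) * ‖x‖ ^ 2) := by ring
      _ ≤ _ := by gcongr

lemma hs_gauss_integrable (b : ℝ) (hb : 0 < b) :
    Integrable (fun x : EuclideanSpace ℝ (Fin n) => Real.exp (-b * ‖x‖ ^ 2)) volume := by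
  by_contra h
  have h1 := GaussianFourier.integral_rexp_neg_mul_sq_norm (V := EuclideanSpace ℝ (Fin n)) hb
  rw [integral_undef h] at h1
  have : 0 < (Real.pi / b) ^ ((Module.finrank ℝ (EuclideanSpace ℝ (Fin n)) : ℝ) / 2) := by
    positivity
  linarith

lemma hs_gauss_eLpNorm (b : ℝ) (hb : 0 < b) :
    eLpNorm (fun x : EuclideanSpace ℝ (Fin n) => Real.exp (-b * ‖x‖ ^ 2)) 1 volume
      = ENNReal.ofReal ((Real.pi / b) ^ ((n : ℝ) / 2)) := by
  rw [eLpNorm_one_eq_lintegral_enorm, ← ofReal_integral_norm_eq_lintegral_enorm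
    (hs_gauss_integrable b hb)]
  simp only [Real.norm_of_nonneg (Real.exp_pos _).le]
  rw [GaussianFourier.integral_rexp_neg_mul_sq_norm hb]
  simp

lemma hs_gauss_lap_eLpNorm (b : ℝ) (hb : 0 < b) :
    eLpNorm (fun x : EuclideanSpace ℝ (Fin n) => Real.exp (-b * ‖x‖ ^ 2) *
        (-2 * b * n + 4 * b ^ 2 * ‖x‖ ^ 2)) 1 volume
      ≤ ENNReal.ofReal (b * (2 * n + 8 * 2 ^ ((n : ℝ) / 2)) * (Real.pi / b) ^ ((n : ℝ) / 2)) := by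
  have hi := (hs_gauss_integrable (n := n) b hb).const_mul (2 * b * n)
  have hi2 := (hs_gauss_integrable (n := n) (b / 2) (by positivity)).const_mul (8 * b)
  have hle : eLpNorm (fun x : EuclideanSpace ℝ (Fin n) => Real.exp (-b * ‖x‖ ^ 2) *
        (-2 * b * n + 4 * b ^ 2 * ‖x‖ ^ 2)) 1 volume ≤
      eLpNorm (fun x : EuclideanSpace ℝ (Fin n) => 2 * b * n * Real.exp (-b * ‖x‖ ^ 2) +
        8 * b * Real.exp (-(b / 2) * ‖x‖ ^ 2)) 1 volume := by
    refine eLpNorm_mono_real fun x => ?_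
    have e : Real.exp (-b * ‖x‖ ^ 2) =
        Real.exp (-(b / 2) * ‖x‖ ^ 2) * Real.exp (-(b / 2) * ‖x‖ ^ 2) := by
      rw [← Real.exp_add]; ring_nf
    have h3 := hs_gauss_sq_bound (b / 2) (by positivity) x
    have h4 : b * (Real.exp (-b * ‖x‖ ^ 2) * ‖x‖ ^ 2) ≤ 2 * Real.exp (-(b / 2) * ‖x‖ ^ 2) := by
      calc _ = b * (Real.exp (-(b / 2) * ‖x‖ ^ 2) * ‖x‖ ^ 2) * Real.exp (-(b / 2) * ‖x‖ ^ 2) := by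
            rw [e]; ring
        _ ≤ b * (1 / (b / 2)) * Real.exp (-(b / 2) * ‖x‖ ^ 2) := by gcongr
        _ = _ := by field_simp
    have hp := Real.exp_pos (-b * ‖x‖ ^ 2)
    have hp2 := Real.exp_pos (-(b / 2) * ‖x‖ ^ 2)
    have hA : 0 ≤ Real.exp (-b * ‖x‖ ^ 2) * (2 * b * n) := by positivity
    have hB : 0 ≤ b * (Real.exp (-b * ‖x‖ ^ 2) * ‖x‖ ^ 2) := by positivity
    rw [Real.norm_eq_abs, abs_le]
    constructor <;> nlinarith
  refine hle.trans (le_of_eq ?_)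
  rw [eLpNorm_one_eq_lintegral_enorm]
  refine (ofReal_integral_norm_eq_lintegral_enorm (hi.add hi2)).symm.trans ?_
  congr 1
  simp only [Pi.add_apply]
  have : ∀ x : EuclideanSpace ℝ (Fin n), ‖2 * b * n * Real.exp (-b * ‖x‖ ^ 2) +
        8 * b * Real.exp (-(b / 2) * ‖x‖ ^ 2)‖ = 2 * b * n * Real.exp (-b * ‖x‖ ^ 2) +
        8 * b * Real.exp (-(b / 2) * ‖x‖ ^ 2) := fun x =>
    Real.norm_of_nonneg (by positivity)
  simp only [this]
  rw [integral_add hi hi2, integral_const_mul, integral_const_mul,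
    GaussianFourier.integral_rexp_neg_mul_sq_norm hb,
    GaussianFourier.integral_rexp_neg_mul_sq_norm (by positivity)]
  have e2 : Real.pi / (b / 2) = 2 * (Real.pi / b) := by field_simp
  rw [e2, Real.mul_rpow (by positivity) (by positivity)]
  simp
  ring

lemma hs_interp (s : ℝ) (hs0 : 0 < s) (hs1 : s < 1) (A B K : ℝ) (hA : 0 ≤ A) (hB : 0 ≤ B)
    (hK : 0 ≤ K) (N : ℝ → ℝ) (hN0 : ∀ t, 0 ≤ N t) (hN1 : ∀ t, 0 < t → N t ≤ B)
    (hN2 : ∀ t, 0 < t → N t ≤ K * A / t) :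
    ∫ t in Set.Ioi (0 : ℝ), t ^ (-s) * N t ≤ (1 / (1 - s) + K / s) * A ^ (1 - s) * B ^ s := by
  have h1s : 0 < 1 - s := by linarith
  by_cases h : A = 0 ∨ B = 0
  · have hN : ∀ t, 0 < t → N t = 0 := by
      intro t ht
      refine le_antisymm ?_ (hN0 t)
      rcases h with h | h
      · simpa [h] using hN2 t ht
      · simpa [h] using hN1 t ht
    rw [setIntegral_congr_fun (g := fun _ => (0:ℝ)) measurableSet_Ioi
      (fun t ht => by simp [hN t ht])]
    simp
    positivity
  push Not at h
  have hA' : 0 < A := lt_of_le_of_ne hA (Ne.symm h.1)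
  have hB' : 0 < B := lt_of_le_of_ne hB (Ne.symm h.2)
  set T := A / B with hT
  have hTp : 0 < T := by positivity
  let g : ℝ → ℝ := fun t => if t ≤ T then B * t ^ (-s) else K * A * t ^ (-s - 1)
  have hg1 : ∀ t ∈ Set.Ioc 0 T, g t = B * t ^ (-s) := fun t ht => if_pos ht.2
  have hg2 : ∀ t ∈ Set.Ioi T, g t = K * A * t ^ (-s - 1) := fun t ht => if_neg (not_le.2 ht)
  have hi1' : IntegrableOn (fun t : ℝ => t ^ (-s)) (Set.Ioc 0 T) := by
    rw [← intervalIntegrable_iff_integrableOn_Ioc_of_le hTp.le]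
    exact intervalIntegral.intervalIntegrable_rpow' (by linarith)
  have hi1 : IntegrableOn g (Set.Ioc 0 T) :=
    IntegrableOn.congr_fun (hi1'.const_mul B) (fun t ht => (hg1 t ht).symm) measurableSet_Ioc
  have hi2 : IntegrableOn g (Set.Ioi T) :=
    IntegrableOn.congr_fun ((integrableOn_Ioi_rpow_of_lt (by linarith) hTp).const_mul (K * A))
      (fun t ht => (hg2 t ht).symm) measurableSet_Ioi
  have hU : Set.Ioi (0:ℝ) = Set.Ioc 0 T ∪ Set.Ioi T := (Set.Ioc_union_Ioi_eq_Ioi hTp.le).symm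
  have hle : ∫ t in Set.Ioi (0 : ℝ), t ^ (-s) * N t ≤ ∫ t in Set.Ioi (0 : ℝ), g t := by
    refine integral_mono_of_nonneg ?_ ?_ ?_
    · filter_upwards [ae_restrict_mem measurableSet_Ioi] with t ht
      exact mul_nonneg (Real.rpow_nonneg (le_of_lt ht) _) (hN0 t)
    · change IntegrableOn g (Set.Ioi 0)
      rw [hU]; exact hi1.union hi2
    · filter_upwards [ae_restrict_mem measurableSet_Ioi] with t ht
      have ht' : 0 < t := ht
      by_cases htT : t ≤ T
      · rw [hg1 t ⟨ht', htT⟩, mul_comm]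
        exact mul_le_mul_of_nonneg_right (hN1 t ht') (Real.rpow_nonneg ht'.le _)
      · rw [hg2 t (not_le.1 htT), Real.rpow_sub_one ht'.ne']
        calc _ ≤ t ^ (-s) * (K * A / t) :=
              mul_le_mul_of_nonneg_left (hN2 t ht') (Real.rpow_nonneg ht'.le _)
          _ = _ := by ring
  refine hle.trans (le_of_eq ?_)
  rw [hU, setIntegral_union (Set.Ioc_disjoint_Ioi le_rfl) measurableSet_Ioi hi1 hi2,
    setIntegral_congr_fun measurableSet_Ioc hg1, setIntegral_congr_fun measurableSet_Ioi hg2,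
    integral_const_mul, integral_const_mul, integral_Ioi_rpow_of_lt (by linarith) hTp,
    ← intervalIntegral.integral_of_le hTp.le, integral_rpow (Or.inl (by linarith))]
  have e1 : -s + 1 = 1 - s := by ring
  have e2 : -s - 1 + 1 = -s := by ring
  rw [e1, e2, Real.zero_rpow h1s.ne', hT, Real.div_rpow hA hB, Real.div_rpow hA hB,
    Real.rpow_sub hA', Real.rpow_sub hB', Real.rpow_neg hA, Real.rpow_neg hB, Real.rpow_one,
    Real.rpow_one]
  have := (Real.rpow_pos_of_pos hA' s).ne'
  have := (Real.rpow_pos_of_pos hB' s).ne'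
  field_simp
  ring

lemma hs_const (n : ℕ) (t : ℝ) (ht : 0 < t) :
    (4 * Real.pi * t) ^ (-(n : ℝ) / 2) * (Real.pi / (1 / (4 * t))) ^ ((n : ℝ) / 2) = 1 := by
  have e : Real.pi / (1 / (4 * t)) = 4 * Real.pi * t := by field_simp
  have hp : 0 < 4 * Real.pi * t := by positivity
  rw [e, ← Real.rpow_add hp]
  have : -(n : ℝ) / 2 + n / 2 = 0 := by ring
  rw [this, Real.rpow_zero]

lemma hs_u_lap_le1 (t : ℝ) (ht : 0 < t) (f : SchwartzMap (EuclideanSpace ℝ (Fin n)) ℝ) :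
    eLpNorm (fun x : EuclideanSpace ℝ (Fin n) =>
            ∑ i : Fin n, fderiv ℝ (fun y : EuclideanSpace ℝ (Fin n) =>
                fderiv ℝ (fun z : EuclideanSpace ℝ (Fin n) =>
                  ∫ w : EuclideanSpace ℝ (Fin n),
                    (4 * Real.pi * t) ^ (-(n : ℝ) / 2) *
                      Real.exp (-‖z - w‖ ^ 2 / (4 * t)) * f w)
                  y (EuclideanSpace.single i 1))
              x (EuclideanSpace.single i 1)) 1 volume
      ≤ eLpNorm (fun x : EuclideanSpace ℝ (Fin n) =>
            ∑ i : Fin n, fderiv ℝ (fun y : EuclideanSpace ℝ (Fin n) =>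
                fderiv ℝ (⇑f) y (EuclideanSpace.single i 1))
              x (EuclideanSpace.single i 1)) 1 volume := by
  have hb : 0 < 1 / (4 * t) := by positivity
  set c := (4 * Real.pi * t) ^ (-(n : ℝ) / 2) with hc
  have hu : (fun z : EuclideanSpace ℝ (Fin n) => ∫ w : EuclideanSpace ℝ (Fin n),
      c * Real.exp (-‖z - w‖ ^ 2 / (4 * t)) * f w) =
      fun z => ∫ w, f (z - w) * (c * Real.exp (-(1 / (4 * t)) * ‖w‖ ^ 2)) := by
    funext z
    rw [← integral_sub_left_eq_self _ volume z]
    refine integral_congr_ae (Filter.Eventually.of_forall fun w => ?_)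
    have : -‖w‖ ^ 2 / (4 * t) = -(1 / (4 * t)) * ‖w‖ ^ 2 := by ring
    simp only [sub_sub_cancel, this]
    ring
  rw [hu]
  have hf : ContDiff ℝ 2 f := f.smooth 2
  let D : Fin n → SchwartzMap (EuclideanSpace ℝ (Fin n)) ℝ := fun i =>
    LineDeriv.lineDerivOp (EuclideanSpace.single i (1:ℝ)) f
  have bd : ∀ g : SchwartzMap (EuclideanSpace ℝ (Fin n)) ℝ, ∀ x, ‖fderiv ℝ g x‖ ≤
      SchwartzMap.seminorm ℝ 0 1 g := by
    intro g x
    have := SchwartzMap.norm_iteratedFDeriv_le_seminorm ℝ g 1 x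
    rwa [norm_iteratedFDeriv_one] at this
  have key := hs_conv_lap f (fun w => c * Real.exp (-(1 / (4 * t)) * ‖w‖ ^ 2)) hf
    (SchwartzMap.seminorm ℝ 0 0 f) (SchwartzMap.seminorm ℝ 0 1 f)
    (∑ i, SchwartzMap.seminorm ℝ 0 1 (D i)) (SchwartzMap.norm_le_seminorm ℝ f) (bd f)
    (fun i x => (bd (D i) x).trans (Finset.single_le_sum
      (f := fun i => SchwartzMap.seminorm ℝ 0 1 (D i)) (fun j _ => apply_nonneg _ _)
      (Finset.mem_univ i)))
    ((hs_gauss_integrable _ hb).const_mul c)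
  rw [funext key]
  refine (hs_young (fun y => ∑ i : Fin n, fderiv ℝ (fun y => fderiv ℝ f y
    (EuclideanSpace.single i 1)) y (EuclideanSpace.single i 1)) _ ?_ ?_).trans ?_
  · refine continuous_finsetSum _ fun i _ => ?_
    exact (LineDeriv.lineDerivOp (EuclideanSpace.single i (1:ℝ)) (D i)).continuous
  · fun_prop
  · have e : eLpNorm (fun w : EuclideanSpace ℝ (Fin n) =>
        c * Real.exp (-(1 / (4 * t)) * ‖w‖ ^ 2)) 1 volume = 1 := by
      have := eLpNorm_const_smul c (fun w : EuclideanSpace ℝ (Fin n) =>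
        Real.exp (-(1 / (4 * t)) * ‖w‖ ^ 2)) 1 volume
      refine this.trans ?_
      have hcp : 0 < c := by positivity
      rw [hs_gauss_eLpNorm _ hb, Real.enorm_of_nonneg hcp.le, ← ENNReal.ofReal_mul hcp.le,
        hs_const n t ht, ENNReal.ofReal_one]
    rw [e, mul_one]

lemma hs_u_lap_le2 (t : ℝ) (ht : 0 < t) (f : SchwartzMap (EuclideanSpace ℝ (Fin n)) ℝ) :
    eLpNorm (fun x : EuclideanSpace ℝ (Fin n) =>
            ∑ i : Fin n, fderiv ℝ (fun y : EuclideanSpace ℝ (Fin n) =>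
                fderiv ℝ (fun z : EuclideanSpace ℝ (Fin n) =>
                  ∫ w : EuclideanSpace ℝ (Fin n),
                    (4 * Real.pi * t) ^ (-(n : ℝ) / 2) *
                      Real.exp (-‖z - w‖ ^ 2 / (4 * t)) * f w)
                  y (EuclideanSpace.single i 1))
              x (EuclideanSpace.single i 1)) 1 volume
      ≤ ENNReal.ofReal ((2 * n + 8 * 2 ^ ((n : ℝ) / 2)) / t) * eLpNorm f 1 volume := by
  have hb : 0 < 1 / (4 * t) := by positivity
  set c := (4 * Real.pi * t) ^ (-(n : ℝ) / 2) with hc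
  have hcp : 0 < c := by positivity
  have hu : (fun z : EuclideanSpace ℝ (Fin n) => ∫ w : EuclideanSpace ℝ (Fin n),
      c * Real.exp (-‖z - w‖ ^ 2 / (4 * t)) * f w) =
      fun z => ∫ w, (fun x : EuclideanSpace ℝ (Fin n) =>
        Real.exp (-(1 / (4 * t)) * ‖x‖ ^ 2)) (z - w) * (c * f w) := by
    funext z
    refine integral_congr_ae (Filter.Eventually.of_forall fun w => ?_)
    have : -‖z - w‖ ^ 2 / (4 * t) = -(1 / (4 * t)) * ‖z - w‖ ^ 2 := by ring
    simp only [this]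
    ring
  rw [hu]
  have hG : ContDiff ℝ 2 (fun x : EuclideanSpace ℝ (Fin n) =>
      Real.exp (-(1 / (4 * t)) * ‖x‖ ^ 2)) :=
    (contDiff_const.mul (contDiff_norm_sq ℝ)).exp
  obtain ⟨b0, b1, b2⟩ := hs_gauss_bounds (n := n) _ hb
  have key := hs_conv_lap _ (fun w => c * f w) hG _ _ _ b0 b1 b2 (f.integrable.const_mul c)
  rw [funext key]
  simp only [hs_gauss_lap]
  refine (hs_young (fun x : EuclideanSpace ℝ (Fin n) => Real.exp (-(1 / (4 * t)) * ‖x‖ ^ 2) *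
        (-2 * (1 / (4 * t)) * n + 4 * (1 / (4 * t)) ^ 2 * ‖x‖ ^ 2)) (fun w => c * f w)
        (by fun_prop) (continuous_const.mul f.continuous)).trans ?_
  have e : eLpNorm (fun w => c * f w) 1 volume = ENNReal.ofReal c * eLpNorm f 1 volume := by
    have := eLpNorm_const_smul c (f : EuclideanSpace ℝ (Fin n) → ℝ) 1 volume
    rw [Real.enorm_of_nonneg hcp.le] at this
    exact this
  rw [e, ← mul_assoc]
  refine mul_le_mul_left ?_ _
  refine (mul_le_mul_left (hs_gauss_lap_eLpNorm _ hb) _).trans ?_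
  rw [← ENNReal.ofReal_mul (by positivity)]
  refine ENNReal.ofReal_le_ofReal ?_
  rw [mul_assoc, mul_comm _ c, hs_const n t ht, mul_one]
  have : 0 ≤ (2 * n + 8 * 2 ^ ((n : ℝ) / 2) : ℝ) := by positivity
  rw [div_mul_eq_mul_div, one_mul]
  gcongr
  linarith

end helpers

/-- **Interpolation estimate for the heat-semigroup representation of the
fractional Laplacian (`L¹`, `0 < σ < 2`):** for every Schwartz function `f`,
`(1/Γ(1−σ/2)) ∫₀^∞ t^{−σ/2} ‖Δ(h_t ∗ f)‖_{L¹} dt ≤ C ‖f‖_{L¹}^{1−σ/2} ‖Δf‖_{L¹}^{σ/2}`. -/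
theorem heat_semigroup_fractional_laplacian_interpolation_L1
    (n : ℕ) (hn : 1 ≤ n) (σ : ℝ) (hσ0 : 0 < σ) (hσ2 : σ < 2) :
    ∃ C > 0, ∀ f : SchwartzMap (EuclideanSpace ℝ (Fin n)) ℝ,
      (1 / Real.Gamma (1 - σ / 2)) *
        ∫ t in Set.Ioi (0 : ℝ), t ^ (-σ / 2) *
          (eLpNorm (fun x : EuclideanSpace ℝ (Fin n) =>
            ∑ i : Fin n, fderiv ℝ (fun y : EuclideanSpace ℝ (Fin n) =>
                fderiv ℝ (fun z : EuclideanSpace ℝ (Fin n) =>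
                  ∫ w : EuclideanSpace ℝ (Fin n),
                    (4 * Real.pi * t) ^ (-(n : ℝ) / 2) *
                      Real.exp (-‖z - w‖ ^ 2 / (4 * t)) * f w)
                  y (EuclideanSpace.single i 1))
              x (EuclideanSpace.single i 1)) 1 volume).toReal
      ≤ C * (eLpNorm (⇑f) 1 volume).toReal ^ (1 - σ / 2) *
          (eLpNorm (fun x : EuclideanSpace ℝ (Fin n) =>
            ∑ i : Fin n, fderiv ℝ (fun y : EuclideanSpace ℝ (Fin n) =>
                fderiv ℝ (⇑f) y (EuclideanSpace.single i 1))
              x (EuclideanSpace.single i 1)) 1 volume).toReal ^ (σ / 2) := by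
  
  have hG : 0 < Real.Gamma (1 - σ / 2) := Real.Gamma_pos_of_pos (by linarith)
  have h1 : 0 < 1 - σ / 2 := by linarith
  set K : ℝ := 2 * n + 8 * 2 ^ ((n : ℝ) / 2) with hK
  have hKp : 0 < K := by positivity
  refine ⟨1 / Real.Gamma (1 - σ / 2) * (1 / (1 - σ / 2) + K / (σ / 2)), by positivity, fun f => ?_⟩
  rw [mul_assoc, mul_assoc, ← mul_assoc (1 / (1 - σ / 2) + K / (σ / 2))]
  refine mul_le_mul_of_nonneg_left ?_ (by positivity)
  have hfin : eLpNorm f 1 volume ≠ ⊤ := (memLp_one_iff_integrable.2 f.integrable).2.ne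
  rw [neg_div]
  refine hs_interp (σ / 2) (by linarith) (by linarith) _ _ K ENNReal.toReal_nonneg
    ENNReal.toReal_nonneg hKp.le _ (fun t => ENNReal.toReal_nonneg) (fun t ht => ?_)
    (fun t ht => ?_)
  · refine ENNReal.toReal_mono ?_ (hs_u_lap_le1 t ht f)
    let S : SchwartzMap (EuclideanSpace ℝ (Fin n)) ℝ := ∑ i : Fin n, LineDeriv.lineDerivOp
      (EuclideanSpace.single i (1:ℝ)) (LineDeriv.lineDerivOp (EuclideanSpace.single i (1:ℝ)) f)
    have hS : (fun x : EuclideanSpace ℝ (Fin n) =>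
            ∑ i : Fin n, fderiv ℝ (fun y : EuclideanSpace ℝ (Fin n) =>
                fderiv ℝ (⇑f) y (EuclideanSpace.single i 1))
              x (EuclideanSpace.single i 1)) = S := by
      funext x
      simp only [S, SchwartzMap.sum_apply]
      rfl
    rw [hS]
    exact (memLp_one_iff_integrable.2 S.integrable).2.ne
  · have h := ENNReal.toReal_mono (ENNReal.mul_ne_top ENNReal.ofReal_ne_top hfin)
      (hs_u_lap_le2 t ht f)
    rw [ENNReal.toReal_mul, ENNReal.toReal_ofReal (by positivity)] at h
    refine h.trans (le_of_eq ?_)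
    rw [hK]
    ring
end
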